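/- Let (X, R) be a symmetric association scheme with n classes, let Y ⊆ X be a T-design and Z ⊆ X a U-design, where T ∪ U = {1, 2, …, n}. Then |Y| · |Z| ≥ |X|. -/

import Mathlib

open Matrix BigOperators
open scoped ComplexOrder

namespace AssocScheme

variable (X : Type*) [Fintype X] [DecidableEq X]

/-- A commutative association scheme with `n` classes on a finite set `X`:
adjacency matrices `A 0, …, A n`, primitive idempotents `E 0, …, E n`,
and intersection numbers `p`. -/
structure Scheme (n : ℕ) where
  A : Fin (n + 1) → Matrix X X ℂ
  E : Fin (n + 1) → Matrix X X ℂ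
  p : Fin (n + 1) → Fin (n + 1) → Fin (n + 1) → ℂ
  A_zeroOne : ∀ i x y, A i x y = 0 ∨ A i x y = 1
  A_zero : A 0 = 1
  A_sum : ∑ i, A i = Matrix.of fun _ _ => (1 : ℂ)
  A_trans : ∀ i, ∃ i', (A i)ᵀ = A i'
  A_mul : ∀ i j, A i * A j = ∑ k, p i j k • A k
  A_comm : ∀ i j, A i * A j = A j * A i
  E_zero : E 0 = (Fintype.card X : ℂ)⁻¹ • Matrix.of fun _ _ => (1 : ℂ)
  E_ne : ∀ i, E i ≠ 0
  E_herm : ∀ i, (E i).IsHermitian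
  E_mul : ∀ i j, E i * E j = if i = j then E i else 0
  E_sum : ∑ i, E i = 1
  E_span : ∀ i, E i ∈ Submodule.span ℂ (Set.range A)

variable {X}
variable {n : ℕ}

/-- The scheme is symmetric: all adjacency matrices are symmetric. -/
def Scheme.IsSym (S : Scheme X n) : Prop := ∀ i, (S.A i)ᵀ = S.A i

/-- `P` is the first eigenmatrix. -/
def Scheme.IsP (S : Scheme X n) (P : Matrix (Fin (n + 1)) (Fin (n + 1)) ℂ) : Prop :=
  ∀ i, S.A i = ∑ j, P j i • S.E j

/-- `Q` is the second eigenmatrix. -/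
def Scheme.IsQ (S : Scheme X n) (Q : Matrix (Fin (n + 1)) (Fin (n + 1)) ℂ) : Prop :=
  ∀ i, S.E i = (Fintype.card X : ℂ)⁻¹ • ∑ j, Q j i • S.A j

/-- `q` is the family of Krein parameters of the scheme. -/
def Scheme.IsKrein (S : Scheme X n) (q : Fin (n + 1) → Fin (n + 1) → Fin (n + 1) → ℂ) : Prop :=
  ∀ i j, Matrix.hadamard (S.E i) (S.E j) = (Fintype.card X : ℂ)⁻¹ • ∑ k, q i j k • S.E k

/-- The scheme is metric (P-polynomial) w.r.t. the given ordering of the `A i`. -/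
def Scheme.Metric (S : Scheme X n) : Prop :=
  ∀ i j k : Fin (n + 1), ((i : ℕ) + (j : ℕ) < (k : ℕ) → S.p i j k = 0) ∧
    ((k : ℕ) = (i : ℕ) + (j : ℕ) → S.p i j k ≠ 0)

/-- The scheme is cometric (Q-polynomial) w.r.t. the given ordering of the `E i`,
with Krein parameters `q`. -/
def Scheme.Cometric (S : Scheme X n) (q : Fin (n + 1) → Fin (n + 1) → Fin (n + 1) → ℂ) : Prop :=
  S.IsKrein q ∧ ∀ i j k : Fin (n + 1), ((i : ℕ) + (j : ℕ) < (k : ℕ) → q i j k = 0) ∧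
    ((k : ℕ) = (i : ℕ) + (j : ℕ) → q i j k ≠ 0)

/-- The scheme is imprimitive: some nontrivial relation is disconnected. -/
def Scheme.Imprimitive (S : Scheme X n) : Prop :=
  ∃ i : Fin (n + 1), i ≠ 0 ∧ ¬ ∀ x y : X, Relation.EqvGen (fun a b => S.A i a b = 1) x y

/-- The inner distribution of a subset `Y`. -/
noncomputable def innerDist (S : Scheme X n) (Y : Finset X) : Fin (n + 1) → ℂ :=
  fun i => (Y.card : ℂ)⁻¹ * ∑ x ∈ Y, ∑ y ∈ Y, S.A i x y

/-- The MacWilliams transform `aQ` of a vector `a`. -/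
noncomputable def macT (Q : Matrix (Fin (n + 1)) (Fin (n + 1)) ℂ) (a : Fin (n + 1) → ℂ) : Fin (n + 1) → ℂ :=
  fun i => ∑ j, a j * Q j i

/-- Entry `B_{x,i}` of the outer distribution of `Y`. -/
noncomputable def outerB (S : Scheme X n) (Y : Finset X) (x : X) (i : Fin (n + 1)) : ℂ :=
  ∑ y ∈ Y, S.A i x y

open scoped Fin.NatCast in
/-- `Y` is completely regular: row `x` of the outer distribution depends only on
`min{j : B_{x,j} ≠ 0}`. -/
def CompletelyRegular (S : Scheme X n) (Y : Finset X) : Prop :=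
  ∀ x x' : X,
    sInf {j : ℕ | outerB S Y x (j : Fin (n + 1)) ≠ 0} =
      sInf {j : ℕ | outerB S Y x' (j : Fin (n + 1)) ≠ 0} →
    ∀ i, outerB S Y x i = outerB S Y x' i

/-- `Y` is regular: `(A_i χ)_x = a_i` for all `x ∈ Y`. -/
def Regular (S : Scheme X n) (Y : Finset X) : Prop :=
  ∀ x ∈ Y, ∀ i, outerB S Y x i = innerDist S Y i

/-- The restriction of the scheme to `Y` (on the `s+1` relations meeting `Y`)
is a symmetric association scheme with `s` classes which is cometric with respect
to some ordering of its primitive idempotents. -/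
def CometricSubscheme (S : Scheme X n) (Y : Finset X) (s : ℕ) : Prop :=
  ∃ f : Fin (s + 1) → Fin (n + 1), Function.Injective f ∧
    (∀ j, f j = 0 ∨ innerDist S Y (f j) ≠ 0) ∧
    (∀ i : Fin (n + 1), (i = 0 ∨ innerDist S Y i ≠ 0) → ∃ j, f j = i) ∧
    ∃ (S' : Scheme {x // x ∈ Y} s) (q' : Fin (s + 1) → Fin (s + 1) → Fin (s + 1) → ℂ),
      (∀ j (y y' : {x // x ∈ Y}), S'.A j y y' = S.A (f j) y.1 y'.1) ∧
      S'.IsSym ∧ S'.Cometric q'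

end AssocScheme

namespace AssocScheme

/-- The quadratic form of the indicator vector of `Y`, as a linear functional. -/
noncomputable def qf {X : Type*} (Y : Finset X) : Matrix X X ℂ →ₗ[ℂ] ℂ where
  toFun M := ∑ x ∈ Y, ∑ y ∈ Y, M x y
  map_add' M N := by simp [Finset.sum_add_distrib]
  map_smul' c M := by simp [Finset.mul_sum]

theorem A_nonneg {X : Type*} [Fintype X] [DecidableEq X] {n : ℕ} (S : Scheme X n)
    (i : Fin (n + 1)) (x y : X) : 0 ≤ S.A i x y := by
  rcases S.A_zeroOne i x y with h | h <;> rw [h]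
  exact zero_le_one

theorem qf_A_nonneg {X : Type*} [Fintype X] [DecidableEq X] {n : ℕ} (S : Scheme X n)
    (Y : Finset X) (i : Fin (n + 1)) : 0 ≤ qf Y (S.A i) :=
  Finset.sum_nonneg fun x _ => Finset.sum_nonneg fun y _ => A_nonneg S i x y

theorem A_disj {X : Type*} [Fintype X] [DecidableEq X] {n : ℕ} (S : Scheme X n)
    {i j : Fin (n + 1)} (hij : i ≠ j) (x y : X) : S.A i x y * S.A j x y = 0 := by
  rcases S.A_zeroOne i x y with h | h
  · simp [h]
  rcases S.A_zeroOne j x y with h' | h'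
  · simp [h']
  exfalso
  have h1 : ∑ k, S.A k x y = 1 := by
    have := congrFun (congrFun S.A_sum x) y
    simpa [Matrix.sum_apply] using this
  have h2 : ∑ k ∈ {i, j}, S.A k x y ≤ ∑ k, S.A k x y :=
    Finset.sum_le_sum_of_subset_of_nonneg (Finset.subset_univ _)
      fun k _ _ => A_nonneg S k x y
  rw [Finset.sum_pair hij, h, h', h1] at h2
  have h3 := (Complex.le_def.1 h2).1
  norm_num at h3

theorem trace_A {X : Type*} [Fintype X] [DecidableEq X] {n : ℕ} (S : Scheme X n)
    (hsym : S.IsSym) (i j : Fin (n + 1)) :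
    (S.A i * S.A j).trace = if i = j then qf Finset.univ (S.A i) else 0 := by
  have hs : ∀ x y, S.A j y x = S.A j x y := fun x y => congrFun (congrFun (hsym j) x) y
  have h0 : (S.A i * S.A j).trace = ∑ x, ∑ y, S.A i x y * S.A j x y := by
    simp [Matrix.trace, Matrix.mul_apply, hs]
  rw [h0]
  split_ifs with h
  · subst h
    refine Finset.sum_congr rfl fun x _ => Finset.sum_congr rfl fun y _ => ?_
    rcases S.A_zeroOne i x y with h | h <;> simp [h]
  · exact Finset.sum_eq_zero fun x _ => Finset.sum_eq_zero fun y _ => A_disj S h x y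

theorem trace_E_ne {X : Type*} [Fintype X] [DecidableEq X] {n : ℕ} (S : Scheme X n)
    (i : Fin (n + 1)) : (S.E i).trace ≠ 0 := by
  intro h
  apply S.E_ne i
  have h1 : (S.E i)ᴴ * S.E i = S.E i := by
    rw [(S.E_herm i).eq, S.E_mul, if_pos rfl]
  exact Matrix.trace_conjTranspose_mul_self_eq_zero_iff.1 (by rw [h1, h])

theorem trace_E {X : Type*} [Fintype X] [DecidableEq X] {n : ℕ} (S : Scheme X n)
    (c : Fin (n + 1) → ℂ) (j : Fin (n + 1)) :
    ((∑ k, c k • S.E k) * S.E j).trace = c j * (S.E j).trace := by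
  simp [Finset.sum_mul, S.E_mul]

theorem span_eq {X : Type*} [Fintype X] [DecidableEq X] {n : ℕ} (S : Scheme X n) :
    Submodule.span ℂ (Set.range S.E) = Submodule.span ℂ (Set.range S.A) := by
  have hli : LinearIndependent ℂ S.E := by
    rw [Fintype.linearIndependent_iff]
    intro c hc j
    have h := trace_E S c j
    rw [hc, zero_mul, Matrix.trace_zero] at h
    exact (mul_eq_zero.1 h.symm).resolve_right (trace_E_ne S j)
  apply Submodule.eq_of_le_of_finrank_le
  · rw [Submodule.span_le]
    rintro _ ⟨i, rfl⟩
    exact S.E_span i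
  · rw [finrank_span_eq_card hli]
    exact finrank_range_le_card S.A

theorem proj_eq {X : Type*} [Fintype X] [DecidableEq X] {n : ℕ} (S : Scheme X n)
    (hsym : S.IsSym) (Y : Finset X) :
    ∑ i, (qf Y (S.A i) * (qf Finset.univ (S.A i))⁻¹) • S.A i =
      ∑ k, (qf Y (S.E k) * ((S.E k).trace)⁻¹) • S.E k := by
  set M := ∑ i, (qf Y (S.A i) * (qf Finset.univ (S.A i))⁻¹) • S.A i with hM
  have hA : ∀ j, (M * S.A j).trace = qf Y (S.A j) := by
    intro j
    have : (M * S.A j).trace =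
        (qf Y (S.A j) * (qf Finset.univ (S.A j))⁻¹) * qf Finset.univ (S.A j) := by
      simp [hM, Finset.sum_mul, Matrix.trace_sum, trace_A S hsym]
    rw [this]
    by_cases h : qf Finset.univ (S.A j) = 0
    · have h1 : qf Y (S.A j) = 0 := by
        have h2 : ∀ x y, S.A j x y = 0 := by
          intro x y
          have h3 := (Finset.sum_eq_zero_iff_of_nonneg (fun x _ =>
            Finset.sum_nonneg fun y _ => A_nonneg S j x y)).1 h x (Finset.mem_univ x)
          exact (Finset.sum_eq_zero_iff_of_nonneg (fun y _ => A_nonneg S j x y)).1 h3 y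
            (Finset.mem_univ y)
        simp [qf, h2]
      simp [h1]
    · field_simp
  have hspan : ∀ N ∈ Submodule.span ℂ (Set.range S.A), (M * N).trace = qf Y N := by
    intro N hN
    induction hN using Submodule.span_induction with
    | mem x hx => obtain ⟨j, rfl⟩ := hx; exact hA j
    | zero => simp
    | add x y _ _ hx hy => rw [mul_add, Matrix.trace_add, hx, hy, map_add]
    | smul c x _ hx => rw [mul_smul_comm, Matrix.trace_smul, hx, map_smul]
  have hMs : M ∈ Submodule.span ℂ (Set.range S.E) := by
    rw [span_eq]
    exact Submodule.sum_mem _ fun i _ => Submodule.smul_mem _ _ (Submodule.subset_span ⟨i, rfl⟩)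
  obtain ⟨c, hc⟩ := (Submodule.mem_span_range_iff_exists_fun ℂ).1 hMs
  rw [← hc]
  refine Finset.sum_congr rfl fun j _ => ?_
  have h := trace_E S c j
  rw [hc, hspan _ (S.E_span j)] at h
  rw [h, mul_assoc, mul_inv_cancel₀ (trace_E_ne S j), mul_one]

theorem qf_E_eq_zero {X : Type*} [Fintype X] [DecidableEq X] {n : ℕ} (S : Scheme X n)
    (Q : Matrix (Fin (n + 1)) (Fin (n + 1)) ℂ) (hQ : S.IsQ Q) (Y : Finset X)
    (hY : 1 < Y.card) (i : Fin (n + 1)) (h : macT Q (innerDist S Y) i = 0) :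
    qf Y (S.E i) = 0 := by
  have hY0 : (Y.card : ℂ)⁻¹ ≠ 0 := inv_ne_zero (by exact_mod_cast (by omega : Y.card ≠ 0))
  have h1 : macT Q (innerDist S Y) i = (Y.card : ℂ)⁻¹ * ∑ j, Q j i * qf Y (S.A j) := by
    rw [Finset.mul_sum]
    refine Finset.sum_congr rfl fun j _ => ?_
    change ((Y.card : ℂ)⁻¹ * qf Y (S.A j)) * Q j i = _
    ring
  rw [h1] at h
  have h2 := (mul_eq_zero.1 h).resolve_left hY0
  rw [hQ i, map_smul, map_sum]
  simp only [map_smul, smul_eq_mul, h2, mul_zero]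

/-- Antidesign bound: if `Y` is a `T`-design and `Z` is a `U`-design with
`T ∪ U = {1,…,n}`, then `|Y|·|Z| ≥ |X|`. -/
theorem antidesign_bound {X : Type*} [Fintype X] [DecidableEq X] [Nonempty X]
    {n : ℕ} (hn : 1 ≤ n) (S : Scheme X n) (hsym : S.IsSym)
    (Q : Matrix (Fin (n + 1)) (Fin (n + 1)) ℂ) (hQ : S.IsQ Q)
    (T U : Finset (Fin (n + 1))) (hTU : T ∪ U = Finset.univ.erase 0)
    (Y Z : Finset X)
    (hY1 : 1 < Y.card) (hY2 : Y.card < Fintype.card X)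
    (hZ1 : 1 < Z.card) (hZ2 : Z.card < Fintype.card X)
    (hYdes : ∀ i ∈ T, macT Q (innerDist S Y) i = 0)
    (hZdes : ∀ i ∈ U, macT Q (innerDist S Z) i = 0) :
    Fintype.card X ≤ Y.card * Z.card := by
  have hX : (0 : ℝ) < Fintype.card X := by exact_mod_cast Fintype.card_pos
  have hXc : (Fintype.card X : ℂ) ≠ 0 := by exact_mod_cast hX.ne'
  have h := congrArg (qf Z) (proj_eq S hsym Y)
  simp only [map_sum, map_smul, smul_eq_mul] at h
  have hA0 : ∀ W : Finset X, qf W (S.A 0) = W.card := by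
    intro W
    rw [S.A_zero]
    simp [qf, Matrix.one_apply]
  have hE0 : ∀ W : Finset X, qf W (S.E 0) = (W.card : ℂ) * W.card * (Fintype.card X : ℂ)⁻¹ := by
    intro W
    rw [S.E_zero]
    simp [qf]
    ring
  have htr : (S.E 0).trace = 1 := by
    rw [S.E_zero]
    simp [Matrix.trace, hXc]
  have hR : ∑ k, qf Y (S.E k) * ((S.E k).trace)⁻¹ * qf Z (S.E k) =
      qf Y (S.E 0) * ((S.E 0).trace)⁻¹ * qf Z (S.E 0) := by
    refine Finset.sum_eq_single 0 (fun k _ hk => ?_) (by simp)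
    have hk' : k ∈ T ∪ U := by rw [hTU]; simp [hk]
    rcases Finset.mem_union.1 hk' with hk' | hk'
    · simp [qf_E_eq_zero S Q hQ Y hY1 k (hYdes k hk')]
    · simp [qf_E_eq_zero S Q hQ Z hZ1 k (hZdes k hk')]
  have hL : qf Y (S.A 0) * (qf Finset.univ (S.A 0))⁻¹ * qf Z (S.A 0) ≤
      ∑ i, qf Y (S.A i) * (qf Finset.univ (S.A i))⁻¹ * qf Z (S.A i) :=
    Finset.single_le_sum (f := fun i => qf Y (S.A i) * (qf Finset.univ (S.A i))⁻¹ * qf Z (S.A i))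
      (fun i _ => mul_nonneg (mul_nonneg (qf_A_nonneg S Y i)
        (inv_nonneg.2 (qf_A_nonneg S _ i))) (qf_A_nonneg S Z i)) (Finset.mem_univ 0)
  rw [h, hR, hA0, hA0, hA0, hE0, hE0, htr, Finset.card_univ] at hL
  have hL' : (Y.card : ℝ) * (Fintype.card X : ℝ)⁻¹ * Z.card ≤
      Y.card * Y.card * (Fintype.card X : ℝ)⁻¹ * 1⁻¹ *
        (Z.card * Z.card * (Fintype.card X : ℝ)⁻¹) := by
    apply Complex.real_le_real.1
    push_cast
    exact hL
  have hy : (0 : ℝ) < Y.card := by exact_mod_cast (by omega : 0 < Y.card)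
  have hz : (0 : ℝ) < Z.card := by exact_mod_cast (by omega : 0 < Z.card)
  have key : (Fintype.card X : ℝ) ≤ Y.card * Z.card := by
    have h5 : (Y.card : ℝ) * Z.card * Fintype.card X ≤ (Y.card * Z.card) * (Y.card * Z.card) := by
      have := mul_le_mul_of_nonneg_right hL' (mul_pos hX hX).le
      field_simp at this ⊢
      nlinarith [mul_pos hy hz]
    exact le_of_mul_le_mul_left h5 (mul_pos hy hz)
  exact_mod_cast key

end AssocScheme
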